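/- For the free product G = (Z/6Z) * (Z/2Z) amalgamated appropriately, i.e. G = Z/4Z *_{Z/2Z} Z/6Z (isomorphic to SL(2,Z)), the rank gradient with respect to any normal chain (H_i) with trivial intersection equals 1/12. -/

import Mathlib

open Filter

/-- `ngen G` is `d(G)`, the minimal number of generators of the group `G`. -/
noncomputable def ngen (G : Type*) [Group G] : ℕ :=
  sInf {n | ∃ S : Finset G, S.card = n ∧ Subgroup.closure (S : Set G) = ⊤}

/-- The two-element family `A, B` of groups, indexed by `Bool`. -/
abbrev Fam (A B : Type u) : Bool → Type u := fun b => bif b then A else B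

instance famGroup {A B : Type u} [Group A] [Group B] : ∀ b, Group (Fam A B b) := fun b =>
  match b with
  | true => ‹Group A›
  | false => ‹Group B›

/-- The pair of homomorphisms `f : C →* A`, `g : C →* B` as a family over `Bool`, so that
`Monoid.PushoutI (fam2 f g)` is the amalgamated free product `A *_C B`. -/
abbrev fam2 {A B : Type u} {C : Type v} [Group A] [Group B] [Group C] (f : C →* A) (g : C →* B) :
    ∀ b, C →* Fam A B b := fun b =>
  match b with
  | true => f
  | false => g

/-- The embedding `ℤ/2 → ℤ/4` (multiplicatively written). -/
noncomputable def incl24 : Multiplicative (ZMod 2) →* Multiplicative (ZMod 4) :=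
  AddMonoidHom.toMultiplicative
    (ZMod.lift 2 ⟨zmultiplesHom (ZMod 4) 2, by simp [zmultiplesHom_apply]; decide⟩)

/-- The embedding `ℤ/2 → ℤ/6` (multiplicatively written). -/
noncomputable def incl26 : Multiplicative (ZMod 2) →* Multiplicative (ZMod 6) :=
  AddMonoidHom.toMultiplicative
    (ZMod.lift 2 ⟨zmultiplesHom (ZMod 6) 3, by simp [zmultiplesHom_apply]; decide⟩)

section graphs

variable {H X Y X' Y' : Type*} [Group H] [MulAction H X] [MulAction H Y]

/-- A tree `(W, F)` lifted from the quotient of the graph with edge ends `α, β` by `H` extends along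
any edge that leaves the orbits of its vertices. -/
theorem extend_lifted_tree (α β : Y → X)
    (hα : ∀ (h : H) y, α (h • y) = h • α y) (hβ : ∀ (h : H) y, β (h • y) = h • β y)
    {π : X → X'} (hπ : ∀ x x', π x = π x' ↔ ∃ h : H, h • x = x')
    {ϖ : Y → Y'} (hϖ : ∀ y y', ϖ y = ϖ y' ↔ ∃ h : H, h • y = y')
    {W : Finset X} {F : Finset Y} (hW : Set.InjOn π W) (hF : Set.InjOn ϖ F)
    (hends : ∀ f ∈ F, α f ∈ W ∧ β f ∈ W)
    {y : Y} (hy : π (α y) ∈ π '' W) (hy' : π (β y) ∉ π '' W) :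
    ∃ (W₁ : Finset X) (F₁ : Finset Y), Set.InjOn π W₁ ∧ Set.InjOn ϖ F₁ ∧
      (∀ f ∈ F₁, α f ∈ W₁ ∧ β f ∈ W₁) ∧ W₁.card = W.card + 1 ∧ F₁.card = F.card + 1 := by
  classical
  obtain ⟨w, hw, hwy⟩ := hy
  obtain ⟨h, rfl⟩ := (hπ _ _).1 hwy.symm
  have hπβ : π (β (h • y)) ∉ π '' W := by
    rw [hβ, ← (hπ (β y) (h • β y)).2 ⟨h, rfl⟩]
    exact hy'
  have hϖy : ϖ (h • y) ∉ ϖ '' F := by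
    rintro ⟨f, hf, hfy⟩
    obtain ⟨k, hk⟩ := (hϖ _ _).1 hfy
    exact hπβ ⟨β f, (hends f hf).2, (hπ _ _).2 ⟨k, by rw [← hβ, hk]⟩⟩
  have hβW : β (h • y) ∉ W := fun hm => hπβ ⟨_, hm, rfl⟩
  have hyF : h • y ∉ F := fun hm => hϖy ⟨_, hm, rfl⟩
  refine ⟨insert (β (h • y)) W, insert (h • y) F, ?_, ?_, ?_, Finset.card_insert_of_notMem hβW,
    Finset.card_insert_of_notMem hyF⟩
  · rw [Finset.coe_insert, Set.injOn_insert (by exact_mod_cast hβW)]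
    exact ⟨hW, hπβ⟩
  · rw [Finset.coe_insert, Set.injOn_insert (by exact_mod_cast hyF)]
    exact ⟨hF, hϖy⟩
  · intro f hf
    rcases Finset.mem_insert.1 hf with rfl | hf
    · rw [hα]
      exact ⟨Finset.mem_insert_of_mem hw, Finset.mem_insert_self _ _⟩
    · exact ⟨Finset.mem_insert_of_mem (hends f hf).1, Finset.mem_insert_of_mem (hends f hf).2⟩

/-- A spanning tree of the quotient of a connected graph by a group lifts to the graph. -/
theorem exists_lifted_spanning_tree [Fintype X'] [Nonempty X] (α β : Y → X)
    (hα : ∀ (h : H) y, α (h • y) = h • α y) (hβ : ∀ (h : H) y, β (h • y) = h • β y)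
    (hconn : ∀ P : Set X, P.Nonempty → (∀ y, α y ∈ P ↔ β y ∈ P) → P = Set.univ)
    {π : X → X'} (hπ : ∀ x x', π x = π x' ↔ ∃ h : H, h • x = x')
    (hsurj : Function.Surjective π)
    {ϖ : Y → Y'} (hϖ : ∀ y y', ϖ y = ϖ y' ↔ ∃ h : H, h • y = y') :
    ∃ (W : Finset X) (F : Finset Y), Set.InjOn π W ∧ Set.InjOn ϖ F ∧
      (∀ f ∈ F, α f ∈ W ∧ β f ∈ W) ∧ π '' W = Set.univ ∧ Fintype.card X' = F.card + 1 := by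
  classical
  have key : ∀ m, 1 ≤ m → m ≤ Fintype.card X' → ∃ (W : Finset X) (F : Finset Y),
      Set.InjOn π W ∧ Set.InjOn ϖ F ∧ (∀ f ∈ F, α f ∈ W ∧ β f ∈ W) ∧
      W.card = m ∧ F.card + 1 = m := by
    intro m hm
    induction m, hm using Nat.le_induction with
    | base =>
      intro _
      obtain ⟨x⟩ := ‹Nonempty X›
      exact ⟨{x}, ∅, by simp, by simp, by simp, by simp, by simp⟩
    | succ m hm ih =>
      intro hmX
      obtain ⟨W, F, hW, hF, hends, hWm, hFm⟩ := ih (by omega)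
      have hP : π ⁻¹' (π '' W) ≠ Set.univ := by
        intro hP
        have hsub : (W.image π) = Finset.univ := by
          ext x'
          obtain ⟨x, rfl⟩ := hsurj x'
          have : x ∈ π ⁻¹' (π '' W) := hP ▸ Set.mem_univ x
          simpa using this
        have := Finset.card_image_le (s := W) (f := π)
        rw [hsub, Finset.card_univ] at this
        omega
      have hne : (π ⁻¹' (π '' W)).Nonempty := by
        obtain ⟨w, hw⟩ := Finset.card_pos.1 (by omega : 0 < W.card)
        exact ⟨w, w, hw, rfl⟩
      have hex : ∃ y, ¬ (α y ∈ π ⁻¹' (π '' W) ↔ β y ∈ π ⁻¹' (π '' W)) := by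
        by_contra! hcon
        exact hP (hconn _ hne hcon)
      obtain ⟨y, hy⟩ := hex
      by_cases hαy : π (α y) ∈ π '' W
      · have hβy : π (β y) ∉ π '' W := fun hb => hy ⟨fun _ => hb, fun _ => hαy⟩
        obtain ⟨W₁, F₁, h1, h2, h3, h4, h5⟩ :=
          extend_lifted_tree α β hα hβ hπ hϖ hW hF hends hαy hβy
        exact ⟨W₁, F₁, h1, h2, h3, by omega, by omega⟩
      · have hβy : π (β y) ∈ π '' W := by
          by_contra hb
          exact hy ⟨fun ha => absurd ha hαy, fun hb' => absurd hb' hb⟩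
        obtain ⟨W₁, F₁, h1, h2, h3, h4, h5⟩ :=
          extend_lifted_tree β α hβ hα hπ hϖ hW hF (fun f hf => (hends f hf).symm) hβy hαy
        exact ⟨W₁, F₁, h1, h2, fun f hf => (h3 f hf).symm, by omega, by omega⟩
  have : Nonempty X' := Nonempty.map π ‹_›
  obtain ⟨W, F, h1, h2, h3, h4, h5⟩ := key _ Fintype.card_pos le_rfl
  refine ⟨W, F, h1, h2, h3, ?_, h5.symm⟩
  have : W.image π = Finset.univ :=
    Finset.eq_univ_of_card _ (by rw [Finset.card_image_of_injOn h1, h4])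
  simpa using congrArg (fun s : Finset X' => (s : Set X')) this

/-- A group acting freely on the vertices of a connected graph is generated by `E - V + 1` elements,
where `V` and `E` are the numbers of orbits of vertices and edges. -/
theorem exists_generating_finset_card_add_le [Fintype X'] [Fintype Y'] [Nonempty X] (α β : Y → X)
    (hα : ∀ (h : H) y, α (h • y) = h • α y) (hβ : ∀ (h : H) y, β (h • y) = h • β y)
    (hconn : ∀ P : Set X, P.Nonempty → (∀ y, α y ∈ P ↔ β y ∈ P) → P = Set.univ)
    (hfree : ∀ (h : H) (x : X), h • x = x → h = 1)
    {π : X → X'} (hπ : ∀ x x', π x = π x' ↔ ∃ h : H, h • x = x')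
    (hsurj : Function.Surjective π)
    {ϖ : Y → Y'} (hϖ : ∀ y y', ϖ y = ϖ y' ↔ ∃ h : H, h • y = y') :
    ∃ S : Finset H, Subgroup.closure (S : Set H) = ⊤ ∧
      S.card + Fintype.card X' ≤ Fintype.card Y' + 1 := by
  classical
  obtain ⟨W, F, hW, hF, hends, hWsurj, hcard⟩ :=
    exists_lifted_spanning_tree α β hα hβ hconn hπ hsurj hϖ
  have hr : ∀ x : X, ∃ r : H, r⁻¹ • x ∈ W := by
    intro x
    obtain ⟨w, hw, hwx⟩ : π x ∈ π '' W := hWsurj ▸ Set.mem_univ _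
    obtain ⟨h, rfl⟩ := (hπ _ _).1 hwx
    exact ⟨h, by simpa using hw⟩
  choose r hr using hr
  have hr_unique : ∀ (x : X) (h : H), h⁻¹ • x ∈ W → r x = h := by
    intro x h hx
    have h1 : (r x)⁻¹ • x = h⁻¹ • x :=
      hW (hr x) hx ((hπ _ _).2 ⟨h⁻¹ * r x, by rw [mul_smul, smul_inv_smul]⟩)
    have h2 := hfree (h * (r x)⁻¹) x (by rw [mul_smul, h1, smul_inv_smul])
    exact (mul_inv_eq_one.1 h2).symm
  have hr_smul : ∀ (h : H) (x : X), r (h • x) = h * r x := fun h x =>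
    hr_unique _ _ (by rw [mul_inv_rev, mul_smul, inv_smul_smul]; exact hr x)
  have hr_one : ∀ w ∈ W, r w = 1 := fun w hw => hr_unique _ _ (by simpa using hw)
  let s : Y → H := fun y => (r (α y))⁻¹ * r (β y)
  have hs : ∀ y y', ϖ y = ϖ y' → s y = s y' := by
    intro y y' hyy
    obtain ⟨h, rfl⟩ := (hϖ _ _).1 hyy
    simp only [s, hα, hβ, hr_smul]
    group
  let s' : Y' → H := Function.extend ϖ s 1
  have hs' : ∀ y, s' (ϖ y) = s y := fun y =>
    Function.FactorsThrough.extend_apply (fun a b hab => hs a b hab) _ _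
  have hgen : ∀ y, s y ∈ Subgroup.closure
      (((Finset.univ \ F.image ϖ).image s' : Finset H) : Set H) := by
    intro y
    by_cases hy : ϖ y ∈ F.image ϖ
    · obtain ⟨f, hf, hfy⟩ := Finset.mem_image.1 hy
      rw [← hs f y hfy]
      simp only [s, hr_one _ (hends f hf).1, hr_one _ (hends f hf).2, inv_one, mul_one]
      exact one_mem _
    · apply Subgroup.subset_closure
      rw [← hs']
      exact Finset.mem_coe.2 (Finset.mem_image_of_mem _ (by simpa using hy))
  refine ⟨(Finset.univ \ F.image ϖ).image s', ?_, ?_⟩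
  · have hne : ∃ w, w ∈ W := by
      obtain ⟨x⟩ := ‹Nonempty X›
      exact ⟨_, hr x⟩
    obtain ⟨w, hw⟩ := hne
    have hall := hconn {x | r x ∈ Subgroup.closure
        (((Finset.univ \ F.image ϖ).image s' : Finset H) : Set H)}
      ⟨w, by rw [Set.mem_ofPred_eq, hr_one w hw]; exact one_mem _⟩ (by
        intro y
        have : r (β y) = r (α y) * s y := by simp [s]
        rw [Set.mem_ofPred_eq, Set.mem_ofPred_eq, this]
        exact (Subgroup.mul_mem_cancel_right _ (hgen y)).symm)
    refine (Subgroup.eq_top_iff' _).2 fun h => ?_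
    have hmem : h • w ∈ {x | r x ∈ Subgroup.closure
        (((Finset.univ \ F.image ϖ).image s' : Finset H) : Set H)} := hall ▸ Set.mem_univ _
    simpa only [Set.mem_ofPred_eq, hr_smul, hr_one w hw, mul_one] using hmem
  · have h1 := Finset.card_image_le (s := Finset.univ \ F.image ϖ) (f := s')
    rw [Finset.card_sdiff_of_subset (Finset.subset_univ _), Finset.card_image_of_injOn hF,
      Finset.card_univ] at h1
    have h2 : F.card ≤ Fintype.card Y' := by
      rw [← Finset.card_image_of_injOn hF]
      exact Finset.card_le_univ _
    omega

/-- A group acting on a connected graph on which every rational `1`-cochain is a coboundary needs at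
least `E - V + 1` generators, where `V` and `E` are the numbers of orbits of vertices and edges. -/
theorem card_add_one_le_of_closure_eq_top [Fintype X'] [Fintype Y'] [Nonempty X] (α β : Y → X)
    (hα : ∀ (h : H) y, α (h • y) = h • α y) (hβ : ∀ (h : H) y, β (h • y) = h • β y)
    (hconn : ∀ P : Set X, P.Nonempty → (∀ y, α y ∈ P ↔ β y ∈ P) → P = Set.univ)
    (hpot : ∀ z : Y → ℚ, ∃ x : X → ℚ, ∀ y, z y = x (β y) - x (α y))
    {π : X → X'} (hπ : ∀ x x', π x = π x' ↔ ∃ h : H, h • x = x')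
    {ϖ : Y → Y'} (hϖ : ∀ y y', ϖ y = ϖ y' ↔ ∃ h : H, h • y = y')
    (hϖsurj : Function.Surjective ϖ)
    (S : Finset H) (hS : Subgroup.closure (S : Set H) = ⊤) :
    Fintype.card Y' + 1 ≤ Fintype.card X' + S.card := by
  classical
  obtain ⟨v⟩ := ‹Nonempty X›
  let d : (X → ℚ) →ₗ[ℚ] (Y → ℚ) := LinearMap.funLeft ℚ ℚ β - LinearMap.funLeft ℚ ℚ α
  have hd : ∀ x y, d x y = x (β y) - x (α y) := fun x y => rfl
  have hϖh : ∀ (h : H) y, ϖ (h • y) = ϖ y := fun h y => ((hϖ _ _).2 ⟨h, rfl⟩).symm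
  have hπh : ∀ (h : H) x, π (h • x) = π x := fun h x => ((hπ _ _).2 ⟨h, rfl⟩).symm
  have hconst : ∀ x : X → ℚ, d x = 0 → ∀ u, x u = x v := by
    intro x hx u
    have := hconn {u | x u = x v} ⟨v, rfl⟩ (fun y => by
      have h1 : d x y = 0 := by rw [hx]; rfl
      rw [hd, sub_eq_zero] at h1
      simp [h1])
    exact (this ▸ Set.mem_univ u : u ∈ {u | x u = x v})
  -- the potentials whose coboundary descends to the quotient
  let P : Submodule ℚ (X → ℚ) := (LinearMap.range (LinearMap.funLeft ℚ ℚ ϖ)).comap d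
  have hP : ∀ x ∈ P, ∀ (h : H) y, d x (h • y) = d x y := by
    rintro x ⟨z, hz⟩ h y
    rw [← hz, LinearMap.funLeft_apply, LinearMap.funLeft_apply, hϖh]
  let e : P →ₗ[ℚ] (Y' → ℚ) × ℚ :=
    ((LinearMap.funLeft ℚ ℚ (Function.surjInv hϖsurj)).comp (d.comp P.subtype)).prod
      ((LinearMap.proj v).comp P.subtype)
  have he : Function.Bijective e := by
    constructor
    · rw [← LinearMap.ker_eq_bot, LinearMap.ker_eq_bot']
      rintro ⟨x, hx⟩ hex
      have h1 : ∀ y', d x (Function.surjInv hϖsurj y') = 0 := fun y' =>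
        congrFun (congrArg Prod.fst hex) y'
      have h2 : x v = 0 := congrArg Prod.snd hex
      have h3 : d x = 0 := by
        funext y
        obtain ⟨h, hh⟩ := (hϖ _ _).1 (Function.surjInv_eq hϖsurj (ϖ y))
        rw [← hh, hP x hx, h1]; rfl
      ext u
      simpa [h2] using hconst x h3 u
    · rintro ⟨z, t⟩
      obtain ⟨x, hx⟩ := hpot (z ∘ ϖ)
      have hdx : d (fun u => x u - x v + t) = z ∘ ϖ := by
        funext y
        rw [hd, hx]; ring
      refine ⟨⟨fun u => x u - x v + t, ⟨z, hdx.symm⟩⟩, Prod.ext ?_ ?_⟩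
      · funext y'
        change d (fun u => x u - x v + t) (Function.surjInv hϖsurj y') = z y'
        rw [hdx, Function.comp_apply, Function.surjInv_eq hϖsurj]
      · change x v - x v + t = t
        ring
  let E := LinearEquiv.ofBijective e he
  have : Module.Finite ℚ P := Module.Finite.equiv E.symm
  have hdim : Module.finrank ℚ P = Fintype.card Y' + 1 := by
    rw [E.finrank_eq]; simp
  let T : P →ₗ[ℚ] (S → ℚ) :=
    (LinearMap.funLeft ℚ ℚ (fun s : S => (s : H) • v) -
      LinearMap.funLeft ℚ ℚ (fun _ : S => v)).comp P.subtype
  have hT : ∀ x s, T x s = (x : X → ℚ) ((s : H) • v) - (x : X → ℚ) v := fun _ _ => rfl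
  have hker : LinearMap.ker T ≤ (LinearMap.range (LinearMap.funLeft ℚ ℚ π)).comap P.subtype := by
    rintro ⟨x, hx⟩ hxT
    have htrans : ∀ (h : H) u, x (h • u) - x u = x (h • v) - x v := by
      intro h u
      have := hconn {u | x (h • u) - x u = x (h • v) - x v} ⟨v, rfl⟩ (fun y => by
        have h1 := hP x hx h y
        rw [hd, hd, hα, hβ] at h1
        simp only [Set.mem_ofPred_eq]
        constructor <;> intro h2 <;> linarith)
      exact (this ▸ Set.mem_univ u : u ∈ {u | x (h • u) - x u = x (h • v) - x v})
    have hinv : ∀ (h : H) u, x (h • u) = x u := by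
      intro h
      have hh : h ∈ Subgroup.closure (S : Set H) := hS ▸ Subgroup.mem_top h
      induction hh using Subgroup.closure_induction with
      | mem s hs =>
        intro u
        have h1 : T ⟨x, hx⟩ ⟨s, hs⟩ = 0 := by rw [LinearMap.mem_ker.1 hxT]; rfl
        rw [hT] at h1
        have := htrans s u
        simp only at h1
        linarith
      | one => simp
      | mul a b _ _ iha ihb => intro u; rw [mul_smul, iha, ihb]
      | inv a _ iha => intro u; rw [← iha, smul_inv_smul]
    refine ⟨Function.extend π x 0, ?_⟩
    funext u
    refine Function.FactorsThrough.extend_apply (fun a b hab => ?_) _ _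
    obtain ⟨h, rfl⟩ := (hπ _ _).1 hab
    exact (hinv h a).symm
  have h1 := LinearMap.finrank_range_add_finrank_ker T
  have h2 : Module.finrank ℚ (LinearMap.range T) ≤ S.card := by
    simpa using Submodule.finrank_le (LinearMap.range T)
  have h3 : Module.finrank ℚ (LinearMap.ker T) ≤ Fintype.card X' := by
    have h4 : (LinearMap.ker T).map P.subtype ≤ LinearMap.range (LinearMap.funLeft ℚ ℚ π) :=
      Submodule.map_le_iff_le_comap.2 hker
    have h5 := Submodule.finrank_mono h4
    rw [Submodule.finrank_map_subtype_eq] at h5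
    have h6 := LinearMap.finrank_range_le (LinearMap.funLeft ℚ ℚ π)
    rw [Module.finrank_fintype_fun_eq_card] at h6
    omega
  omega

end graphs

section amalgam

variable {G : Type*} [Group G]

/-- The map induced on coset spaces by the projection `G → G ⧸ H`. -/
def cosetProj (H A : Subgroup G) [H.Normal] :
    G ⧸ A → (G ⧸ H) ⧸ A.map (QuotientGroup.mk' H) :=
  Quotient.map' (QuotientGroup.mk' H) fun x y hxy => by
    rw [QuotientGroup.leftRel_apply] at hxy ⊢
    rw [← map_inv, ← map_mul]
    exact Subgroup.mem_map_of_mem _ hxy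

theorem cosetProj_mk (H A : Subgroup G) [H.Normal] (g : G) :
    cosetProj H A (g : G ⧸ A) = ((g : G ⧸ H) : (G ⧸ H) ⧸ A.map (QuotientGroup.mk' H)) := rfl

theorem cosetProj_surjective (H A : Subgroup G) [H.Normal] :
    Function.Surjective (cosetProj H A) := by
  intro x
  obtain ⟨q, rfl⟩ := QuotientGroup.mk_surjective x
  obtain ⟨g, rfl⟩ := QuotientGroup.mk_surjective q
  exact ⟨g, rfl⟩

theorem cosetProj_eq_iff (H A : Subgroup G) [H.Normal] (x x' : G ⧸ A) :
    cosetProj H A x = cosetProj H A x' ↔ ∃ h : H, h • x = x' := by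
  obtain ⟨g, rfl⟩ := QuotientGroup.mk_surjective x
  obtain ⟨g', rfl⟩ := QuotientGroup.mk_surjective x'
  rw [cosetProj_mk, cosetProj_mk, QuotientGroup.eq]
  constructor
  · rintro ⟨a, ha, hag⟩
    have h1 : ((g * a : G) : G ⧸ H) = (g' : G ⧸ H) := by
      have : (a : G ⧸ H) = (g : G ⧸ H)⁻¹ * (g' : G ⧸ H) := hag
      rw [QuotientGroup.mk_mul, this, mul_inv_cancel_left]
    have h2 : g' * (g * a)⁻¹ ∈ H :=
      (Subgroup.Normal.mem_comm_iff inferInstance).1 (QuotientGroup.eq.1 h1)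
    refine ⟨⟨_, h2⟩, ?_⟩
    change ((g' * (g * a)⁻¹ * g : G) : G ⧸ A) = _
    rw [QuotientGroup.eq]
    convert SetLike.mem_coe.1 ha using 1
    group
  · rintro ⟨h, hh⟩
    change ((h * g : G) : G ⧸ A) = _ at hh
    rw [QuotientGroup.eq] at hh
    refine ⟨_, hh, ?_⟩
    simp

theorem card_quotient_map_mul_card (H A : Subgroup G) [H.Normal] (hHA : H ⊓ A = ⊥) :
    Nat.card ((G ⧸ H) ⧸ A.map (QuotientGroup.mk' H)) * Nat.card A = H.index := by
  have hinj : Function.Injective ((QuotientGroup.mk' H).subgroupMap A) := by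
    rw [← MonoidHom.ker_eq_bot_iff, eq_bot_iff]
    rintro ⟨a, ha⟩ h
    have h1 : ((a : G) : G ⧸ H) = 1 := congrArg Subtype.val h
    have h2 : a ∈ H ⊓ A := ⟨(QuotientGroup.eq_one_iff _).1 h1, ha⟩
    rw [hHA, Subgroup.mem_bot] at h2
    exact Subtype.ext h2
  rw [Nat.card_congr (Equiv.ofBijective _ ⟨hinj, (QuotientGroup.mk' H).subgroupMap_surjective A⟩),
    ← Subgroup.card_eq_card_quotient_mul_card_subgroup, Subgroup.index]

theorem eq_one_of_smul_coset_eq {H A : Subgroup G} [H.Normal] (hHA : H ⊓ A = ⊥)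
    (h : H) (x : G ⧸ A) (hx : h • x = x) : h = 1 := by
  obtain ⟨g, rfl⟩ := QuotientGroup.mk_surjective x
  have h1 : (g⁻¹ * h * g)⁻¹ ∈ A := by
    have : ((h * g : G) : G ⧸ A) = g := hx
    rw [QuotientGroup.eq] at this
    convert this using 1
    group
  have h2 : g⁻¹ * h * g ∈ H ⊓ A :=
    ⟨by simpa using Subgroup.Normal.conj_mem inferInstance (h : G) h.2 g⁻¹, (inv_mem_iff (H := A)).1 h1⟩
  rw [hHA, Subgroup.mem_bot] at h2
  ext
  simpa [mul_assoc, inv_mul_eq_one, eq_comm] using h2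

/-- If `G` is generated by finite subgroups `A` and `B` with common subgroup `C`, and the graph of
cosets of `A` and `B` is acyclic in the sense that its rational `1`-cochains are coboundaries, then
a normal subgroup `H` of finite index that meets `A` and `B` trivially satisfies
`d(H) - 1 = [G : H] (1/|C| - 1/|A| - 1/|B|)`. -/
theorem ngen_of_amalgam {A B C : Subgroup G} (hCA : C ≤ A) (hCB : C ≤ B) (hAB : A ⊔ B = ⊤)
    [Finite A] [Finite B]
    (hpot : ∀ z : G ⧸ C → ℚ, ∃ (x : G ⧸ A → ℚ) (x' : G ⧸ B → ℚ), ∀ g : G, z g = x' g - x g)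
    (H : Subgroup G) [H.Normal] (hH : H.index ≠ 0) (hHA : H ⊓ A = ⊥) (hHB : H ⊓ B = ⊥) :
    (ngen H : ℝ) - 1 =
      H.index * (1 / (Nat.card C : ℝ) - 1 / (Nat.card A : ℝ) - 1 / (Nat.card B : ℝ)) := by
  classical
  have hHC : H ⊓ C = ⊥ := eq_bot_iff.2 (hHA ▸ inf_le_inf_left H hCA)
  have : H.FiniteIndex := ⟨hH⟩
  have : Finite C := Finite.of_injective _ (Subgroup.inclusion_injective hCA)
  let _ : ∀ K : Subgroup (G ⧸ H), Fintype ((G ⧸ H) ⧸ K) := fun K => Fintype.ofFinite _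
  let α : G ⧸ C → (G ⧸ A) ⊕ (G ⧸ B) := fun y => Sum.inl (Subgroup.quotientMapOfLE hCA y)
  let β : G ⧸ C → (G ⧸ A) ⊕ (G ⧸ B) := fun y => Sum.inr (Subgroup.quotientMapOfLE hCB y)
  have hα : ∀ (h : H) y, α (h • y) = h • α y := by
    rintro h ⟨y⟩; rfl
  have hβ : ∀ (h : H) y, β (h • y) = h • β y := by
    rintro h ⟨y⟩; rfl
  have hconn : ∀ P : Set ((G ⧸ A) ⊕ (G ⧸ B)), P.Nonempty → (∀ y, α y ∈ P ↔ β y ∈ P) →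
      P = Set.univ := by
    intro P hPne hP
    have hP' : ∀ g : G, Sum.inl (g : G ⧸ A) ∈ P ↔ Sum.inr (g : G ⧸ B) ∈ P := fun g =>
      hP (g : G ⧸ C)
    have hmul : ∀ k g : G, Sum.inl ((g * k : G) : G ⧸ A) ∈ P ↔ Sum.inl (g : G ⧸ A) ∈ P := by
      intro k
      have hk : k ∈ A ⊔ B := hAB ▸ Subgroup.mem_top k
      rw [Subgroup.sup_eq_closure] at hk
      induction hk using Subgroup.closure_induction with
      | mem k hk =>
        intro g
        rcases hk with hk | hk
        · rw [QuotientGroup.mk_mul_of_mem g hk]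
        · rw [hP', hP', QuotientGroup.mk_mul_of_mem g hk]
      | one => simp
      | mul a b _ _ iha ihb => intro g; rw [← mul_assoc, ihb, iha]
      | inv a _ iha => intro g; rw [← iha, inv_mul_cancel_right]
    obtain ⟨g, hg⟩ : ∃ g : G, Sum.inl (g : G ⧸ A) ∈ P := by
      obtain ⟨x | x, hx⟩ := hPne <;> obtain ⟨g, rfl⟩ := QuotientGroup.mk_surjective x
      · exact ⟨g, hx⟩
      · exact ⟨g, (hP' g).2 hx⟩
    have hall : ∀ k : G, Sum.inl (k : G ⧸ A) ∈ P := fun k => by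
      have := (hmul (g⁻¹ * k) g).2 hg
      rwa [mul_inv_cancel_left] at this
    refine Set.eq_univ_of_forall ?_
    rintro (x | x) <;> obtain ⟨k, rfl⟩ := QuotientGroup.mk_surjective x
    · exact hall k
    · exact (hP' k).1 (hall k)
  have hfree : ∀ (h : H) (x : (G ⧸ A) ⊕ (G ⧸ B)), h • x = x → h = 1 := by
    rintro h (x | x) hx
    · exact eq_one_of_smul_coset_eq hHA h x (Sum.inl_injective hx)
    · exact eq_one_of_smul_coset_eq hHB h x (Sum.inr_injective hx)
  have hπ : ∀ x x', Sum.map (cosetProj H A) (cosetProj H B) x =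
      Sum.map (cosetProj H A) (cosetProj H B) x' ↔ ∃ h : H, h • x = x' := by
    rintro (x | x) (x' | x') <;> simp [cosetProj_eq_iff]
  have hsurj : Function.Surjective (Sum.map (cosetProj H A) (cosetProj H B)) :=
    Function.Surjective.sumMap (cosetProj_surjective H A) (cosetProj_surjective H B)
  have hpot' : ∀ z : G ⧸ C → ℚ, ∃ x : (G ⧸ A) ⊕ (G ⧸ B) → ℚ, ∀ y, z y = x (β y) - x (α y) := by
    intro z
    obtain ⟨x, x', hx⟩ := hpot z
    refine ⟨Sum.elim x x', ?_⟩
    rintro ⟨g⟩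
    exact hx g
  obtain ⟨S, hS, hScard⟩ := exists_generating_finset_card_add_le α β hα hβ hconn hfree hπ hsurj
    (cosetProj_eq_iff H C)
  have hle : ngen H ≤ S.card := Nat.sInf_le ⟨S, rfl, hS⟩
  obtain ⟨S', hS'card, hS'⟩ : ∃ S : Finset H, S.card = ngen H ∧ Subgroup.closure (S : Set H) = ⊤ :=
    Nat.sInf_mem (s := {n | ∃ S : Finset H, S.card = n ∧ Subgroup.closure (S : Set H) = ⊤})
      ⟨_, S, rfl, hS⟩
  have hge := card_add_one_le_of_closure_eq_top α β hα hβ hconn hpot' hπ (cosetProj_eq_iff H C)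
    (cosetProj_surjective H C) S' hS'
  rw [Fintype.card_sum, ← Nat.card_eq_fintype_card, ← Nat.card_eq_fintype_card,
    ← Nat.card_eq_fintype_card] at hScard hge
  have hA := card_quotient_map_mul_card H A hHA
  have hB := card_quotient_map_mul_card H B hHB
  have hC := card_quotient_map_mul_card H C hHC
  have hcard : ∀ K : Subgroup G, Finite K → (Nat.card K : ℝ) ≠ 0 := fun K _ =>
    Nat.cast_ne_zero.2 Nat.card_pos.ne'
  have hcA := hcard A ‹_›
  have hcB := hcard B ‹_›
  have hcC := hcard C ‹_›
  have heq : ngen H + (Nat.card ((G ⧸ H) ⧸ A.map (QuotientGroup.mk' H)) +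
      Nat.card ((G ⧸ H) ⧸ B.map (QuotientGroup.mk' H))) =
      Nat.card ((G ⧸ H) ⧸ C.map (QuotientGroup.mk' H)) + 1 := by omega
  have key : ∀ (K : Subgroup G), (Nat.card K : ℝ) ≠ 0 →
      Nat.card ((G ⧸ H) ⧸ K.map (QuotientGroup.mk' H)) * Nat.card K = H.index →
      (H.index : ℝ) * (1 / (Nat.card K : ℝ)) =
        (Nat.card ((G ⧸ H) ⧸ K.map (QuotientGroup.mk' H)) : ℝ) := by
    intro K hK hidx
    rw [← hidx]
    push_cast
    field_simp
  rw [mul_sub, mul_sub, key A hcA hA, key B hcB hB, key C hcC hC]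
  have heq' : (ngen H : ℝ) + (Nat.card ((G ⧸ H) ⧸ A.map (QuotientGroup.mk' H)) +
      Nat.card ((G ⧸ H) ⧸ B.map (QuotientGroup.mk' H))) =
      Nat.card ((G ⧸ H) ⧸ C.map (QuotientGroup.mk' H)) + 1 := by exact_mod_cast heq
  linarith

end amalgam

section pushout

open Monoid

variable {A B : Type u} {C : Type v} [Group A] [Group B] [Group C] (f : C →* A) (g : C →* B)

theorem pushout_induction {motive : PushoutI (fam2 f g) → Prop} (x : PushoutI (fam2 f g))
    (left : ∀ a : A, motive (PushoutI.of (φ := fam2 f g) true a))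
    (right : ∀ b : B, motive (PushoutI.of (φ := fam2 f g) false b))
    (mul : ∀ x y, motive x → motive y → motive (x * y)) : motive x := by
  refine PushoutI.induction_on x (fun i => ?_) (fun c => ?_) mul
  · cases i
    · exact right
    · exact left
  · rw [← PushoutI.of_apply_eq_base (fam2 f g) true]
    exact left _

theorem range_of_sup_range_of :
    (PushoutI.of (φ := fam2 f g) true).range ⊔ (PushoutI.of (φ := fam2 f g) false).range = ⊤ := by
  refine (Subgroup.eq_top_iff' _).2 fun x => ?_
  exact pushout_induction f g x (fun a => Subgroup.mem_sup_left ⟨a, rfl⟩)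
    (fun b => Subgroup.mem_sup_right ⟨b, rfl⟩) (fun _ _ => mul_mem)

theorem range_base_le (i : Bool) :
    (PushoutI.base (fam2 f g)).range ≤ (PushoutI.of (φ := fam2 f g) i).range := by
  rintro _ ⟨c, rfl⟩
  exact ⟨_, PushoutI.of_apply_eq_base (fam2 f g) i c⟩

/-- The universal property of the amalgam `A *_C B`. -/
def pushoutLift {K : Type*} [Group K] (p : A →* K) (q : B →* K) (hpq : p.comp f = q.comp g) :
    PushoutI (fam2 f g) →* K :=
  PushoutI.lift (fun i => match i with
    | true => p
    | false => q) (q.comp g) (fun i => match i with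
    | true => hpq
    | false => rfl)

variable {f g} in
theorem pushoutLift_left {K : Type*} [Group K] {p : A →* K} {q : B →* K}
    (hpq : p.comp f = q.comp g) (a : A) :
    pushoutLift f g p q hpq (PushoutI.of (φ := fam2 f g) true a) = p a :=
  PushoutI.lift_of _ _ _ _

variable {f g} in
theorem pushoutLift_right {K : Type*} [Group K] {p : A →* K} {q : B →* K}
    (hpq : p.comp f = q.comp g) (b : B) :
    pushoutLift f g p q hpq (PushoutI.of (φ := fam2 f g) false b) = q b :=
  PushoutI.lift_of _ _ _ _

/-- The action of `G` on `G × ℚ` through right translations of the first factor. -/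
def rightTranslation (G : Type*) [Group G] : G →* Equiv.Perm (G × ℚ) where
  toFun g := (Equiv.mulRight g⁻¹).prodCongr (Equiv.refl ℚ)
  map_one' := by ext <;> simp
  map_mul' x y := by ext <;> simp [mul_assoc]

/-- The shear of `G × ℚ` along the function `z`. -/
def shear {G : Type*} (z : G → ℚ) : Equiv.Perm (G × ℚ) where
  toFun p := (p.1, p.2 + z p.1)
  invFun p := (p.1, p.2 - z p.1)
  left_inv p := by simp
  right_inv p := by simp

/-- Every rational function on the edges of the Bass–Serre tree of `A *_C B` is a coboundary. -/
theorem exists_potential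
    (z : PushoutI (fam2 f g) ⧸ (PushoutI.base (fam2 f g)).range → ℚ) :
    ∃ (x : PushoutI (fam2 f g) ⧸ (PushoutI.of (φ := fam2 f g) true).range → ℚ)
      (x' : PushoutI (fam2 f g) ⧸ (PushoutI.of (φ := fam2 f g) false).range → ℚ),
      ∀ k : PushoutI (fam2 f g), z k = x' k - x k := by
  set G := PushoutI (fam2 f g)
  let ζ : G → ℚ := fun k => z k
  let R := rightTranslation G
  let inA : A →* G := PushoutI.of (φ := fam2 f g) true
  let inB : B →* G := PushoutI.of (φ := fam2 f g) false
  have hC : ∀ c, inA (f c) = inB (g c) := fun c =>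
    (PushoutI.of_apply_eq_base (fam2 f g) true c).trans
      (PushoutI.of_apply_eq_base (fam2 f g) false c).symm
  have hζ : ∀ (k : G) (c : C), ζ (k * (inB (g c))⁻¹) = ζ k := fun k c =>
    congrArg z (QuotientGroup.mk_mul_of_mem k (inv_mem
      ⟨c, (PushoutI.of_apply_eq_base (fam2 f g) false c).symm⟩))
  let ρ : G →* Equiv.Perm (G × ℚ) := pushoutLift f g
    ((MulAut.conj (shear ζ)).toMonoidHom.comp (R.comp inA)) (R.comp inB) (by
      ext1 c
      change shear ζ * R (inA (f c)) * (shear ζ)⁻¹ = R (inB (g c))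
      rw [mul_inv_eq_iff_eq_mul, hC]
      ext p
      · rfl
      · exact congrArg (p.2 + ·) (hζ p.1 c))
  have hρA : ∀ a p, ρ (inA a) p =
      (p.1 * (inA a)⁻¹, p.2 - ζ p.1 + ζ (p.1 * (inA a)⁻¹)) := by
    intro a p
    rw [show ρ (inA a) = _ from pushoutLift_left _ a]
    rfl
  have hρB : ∀ b p, ρ (inB b) p = (p.1 * (inB b)⁻¹, p.2) := by
    intro b p
    rw [show ρ (inB b) = _ from pushoutLift_right _ b]
    rfl
  have hfst : ∀ (k : G) p, (ρ k p).1 = p.1 * k⁻¹ := by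
    intro k
    refine pushout_induction f g (motive := fun k : G => ∀ p, (ρ k p).1 = p.1 * k⁻¹) k
      (fun a p => ?_) (fun b p => ?_) (fun x y hx hy p => ?_)
    · exact congrArg Prod.fst (hρA a p)
    · exact congrArg Prod.fst (hρB b p)
    · rw [map_mul, Equiv.Perm.mul_apply, hx, hy, mul_inv_rev, mul_assoc]
  let w : G → ℚ := fun k => (ρ k⁻¹ (1, 0)).2
  have hw : ∀ k, ρ k⁻¹ (1, 0) = (k, w k) := fun k =>
    Prod.ext (by rw [hfst, inv_inv, one_mul]) rfl
  have hwA : ∀ k a, w (k * inA a) - ζ (k * inA a) = w k - ζ k := by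
    intro k a
    have h1 : w (k * inA a) = (ρ (inA a⁻¹) (ρ k⁻¹ (1, 0))).2 := by
      rw [← Equiv.Perm.mul_apply, ← map_mul, map_inv, ← mul_inv_rev]
    rw [h1, hw, hρA, map_inv, inv_inv]
    ring
  have hwB : ∀ k b, w (k * inB b) = w k := by
    intro k b
    have h1 : w (k * inB b) = (ρ (inB b⁻¹) (ρ k⁻¹ (1, 0))).2 := by
      rw [← Equiv.Perm.mul_apply, ← map_mul, map_inv, ← mul_inv_rev]
    rw [h1, hw, hρB]
  refine ⟨fun q => Quotient.liftOn' q (fun k => w k - ζ k) ?_,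
    fun q => Quotient.liftOn' q w ?_, fun k => ?_⟩
  · intro k l hkl
    obtain ⟨a, ha⟩ := QuotientGroup.leftRel_apply.1 hkl
    have : l = k * inA a := by rw [show inA a = k⁻¹ * l from ha, mul_inv_cancel_left]
    rw [this]
    exact (hwA k a).symm
  · intro k l hkl
    obtain ⟨b, hb⟩ := QuotientGroup.leftRel_apply.1 hkl
    have : l = k * inB b := by rw [show inB b = k⁻¹ * l from hb, mul_inv_cancel_left]
    rw [this]
    exact (hwB k b).symm
  · change ζ k = w k - (w k - ζ k)
    ring

end pushout

section modular

open Monoid Multiplicative ModularGroup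

/-- The homomorphism `ℤ/n → K` (multiplicatively written) sending the generator to `k`. -/
def zmodPowHom {K : Type*} [Group K] (n : ℕ) (k : K) (hk : k ^ n = 1) :
    Multiplicative (ZMod n) →* K :=
  AddMonoidHom.toMultiplicativeLeft
    (ZMod.lift n ⟨zmultiplesHom (Additive K) (Additive.ofMul k), by
      rw [zmultiplesHom_apply, natCast_zsmul, ← ofMul_pow, hk, ofMul_one]⟩)

theorem zmodPowHom_natCast {K : Type*} [Group K] (n : ℕ) (k : K) (hk : k ^ n = 1) (m : ℕ) :
    zmodPowHom n k hk (ofAdd (m : ZMod n)) = k ^ m := by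
  have h := ZMod.lift_coe n (⟨zmultiplesHom (Additive K) (Additive.ofMul k), by
      rw [zmultiplesHom_apply, natCast_zsmul, ← ofMul_pow, hk, ofMul_one]⟩ :
      { f : ℤ →+ Additive K // f n = 0 }) m
  rw [Int.cast_natCast] at h
  have h' := congrArg Additive.toMul h
  refine h'.trans ?_
  change Additive.toMul ((zmultiplesHom (Additive K) (Additive.ofMul k)) (m : ℤ)) = k ^ m
  rw [zmultiplesHom_apply, natCast_zsmul, toMul_nsmul, toMul_ofMul]

theorem ofAdd_eq_pow {n : ℕ} [NeZero n] (x : Multiplicative (ZMod n)) :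
    x = (ofAdd (1 : ZMod n)) ^ (toAdd x).val := by
  rw [← ofAdd_nsmul, nsmul_one, ZMod.natCast_val, ZMod.cast_id', id, ofAdd_toAdd]

theorem incl24_ofAdd_one : incl24 (ofAdd 1) = ofAdd 2 := by
  have h := ZMod.lift_coe 2 (⟨zmultiplesHom (ZMod 4) 2, by decide⟩ :
    { f : ℤ →+ ZMod 4 // f (2 : ℕ) = 0 }) 1
  rw [Int.cast_one] at h
  exact congrArg ofAdd (h.trans (one_zsmul (2 : ZMod 4)))

theorem incl26_ofAdd_one : incl26 (ofAdd 1) = ofAdd 3 := by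
  have h := ZMod.lift_coe 2 (⟨zmultiplesHom (ZMod 6) 3, by decide⟩ :
    { f : ℤ →+ ZMod 6 // f (2 : ℕ) = 0 }) 1
  rw [Int.cast_one] at h
  exact congrArg ofAdd (h.trans (one_zsmul (3 : ZMod 6)))

theorem injective_of_ofAdd_one_ne {K : Type*} [Group K] (f : Multiplicative (ZMod 2) →* K)
    (hf : f (ofAdd 1) ≠ 1) : Function.Injective f := by
  rw [injective_iff_map_eq_one]
  intro x hx
  have : ∀ y : Multiplicative (ZMod 2), y = 1 ∨ y = ofAdd 1 := by decide
  rcases this x with rfl | rfl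
  · rfl
  · exact absurd hx hf

theorem fam2_injective : ∀ i, Function.Injective (fam2 incl24 incl26 i)
  | true => injective_of_ofAdd_one_ne incl24 (by rw [incl24_ofAdd_one]; decide)
  | false => injective_of_ofAdd_one_ne incl26 (by rw [incl26_ofAdd_one]; decide)

/-- The generator of order four of the amalgam. -/
noncomputable def genA : PushoutI (fam2 incl24 incl26) :=
  PushoutI.of (φ := fam2 incl24 incl26) true (ofAdd (1 : ZMod 4))

/-- The generator of order six of the amalgam. -/
noncomputable def genB : PushoutI (fam2 incl24 incl26) :=
  PushoutI.of (φ := fam2 incl24 incl26) false (ofAdd (1 : ZMod 6))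

theorem of_true_eq_genA_pow (x : Multiplicative (ZMod 4)) :
    PushoutI.of (φ := fam2 incl24 incl26) true x = genA ^ (toAdd x).val := by
  conv_lhs => rw [ofAdd_eq_pow x]
  exact map_pow _ _ _

theorem of_false_eq_genB_pow (x : Multiplicative (ZMod 6)) :
    PushoutI.of (φ := fam2 incl24 incl26) false x = genB ^ (toAdd x).val := by
  conv_lhs => rw [ofAdd_eq_pow x]
  exact map_pow _ _ _

theorem genA_sq_eq_genB_pow : genA ^ 2 = genB ^ 3 := by
  have h1 := PushoutI.of_apply_eq_base (fam2 incl24 incl26) true (ofAdd 1)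
  have h2 := PushoutI.of_apply_eq_base (fam2 incl24 incl26) false (ofAdd 1)
  have h3 := h1.trans h2.symm
  have e1 : fam2 incl24 incl26 true (ofAdd 1) = (ofAdd 2 : Multiplicative (ZMod 4)) :=
    incl24_ofAdd_one
  have e2 : fam2 incl24 incl26 false (ofAdd 1) = (ofAdd 3 : Multiplicative (ZMod 6)) :=
    incl26_ofAdd_one
  rw [e1, e2] at h3
  exact (of_true_eq_genA_pow (ofAdd 2)).symm.trans (h3.trans (of_false_eq_genB_pow (ofAdd 3)))

theorem genA_pow_four : genA ^ 4 = 1 :=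
  (map_pow (PushoutI.of (φ := fam2 incl24 incl26) true) (ofAdd (1 : ZMod 4)) 4).symm.trans
    (map_one (PushoutI.of (φ := fam2 incl24 incl26) true))

/-- The image in `SL(2, ℤ)` of the generator of order six. -/
def sixGen : Matrix.SpecialLinearGroup (Fin 2) ℤ := (S * T)⁻¹

/-- The canonical homomorphism from the amalgam to `SL(2, ℤ)`. -/
noncomputable def toSL2Z : PushoutI (fam2 incl24 incl26) →* Matrix.SpecialLinearGroup (Fin 2) ℤ :=
  pushoutLift incl24 incl26 (zmodPowHom 4 S (by decide)) (zmodPowHom 6 sixGen (by decide)) (by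
    refine MonoidHom.ext fun x => ?_
    rw [ofAdd_eq_pow x, map_pow, map_pow]
    congr 1
    rw [MonoidHom.comp_apply, MonoidHom.comp_apply, incl24_ofAdd_one, incl26_ofAdd_one]
    have h1 := zmodPowHom_natCast 4 S (by decide) 2
    have h2 := zmodPowHom_natCast 6 sixGen (by decide) 3
    rw [Nat.cast_ofNat] at h1 h2
    rw [h1, h2]
    decide)

theorem toSL2Z_genA : toSL2Z genA = S := by
  refine (pushoutLift_left _ _).trans ?_
  have h := zmodPowHom_natCast 4 S (by decide) 1
  rw [Nat.cast_one, pow_one] at h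
  exact h

theorem toSL2Z_genB : toSL2Z genB = sixGen := by
  refine (pushoutLift_right _ _).trans ?_
  have h := zmodPowHom_natCast 6 sixGen (by decide) 1
  rw [Nat.cast_one, pow_one] at h
  exact h

theorem toSL2Z_surjective : Function.Surjective toSL2Z := by
  rw [← MonoidHom.range_eq_top, eq_top_iff, ← SpecialLinearGroup.SL2Z_generators, Subgroup.closure_le]
  rintro x (rfl | rfl)
  · exact ⟨genA, toSL2Z_genA⟩
  · refine ⟨genA * genB ^ 2, ?_⟩
    rw [map_mul, map_pow, toSL2Z_genA, toSL2Z_genB]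
    decide

/-- The elements of the amalgam that are positive words in `ab` and `ab²`. -/
noncomputable def positiveWords : Submonoid (PushoutI (fam2 incl24 incl26)) :=
  Submonoid.closure {genA * genB, genA * genB ^ 2}

theorem positiveWords_cases {m : PushoutI (fam2 incl24 incl26)} (hm : m ∈ positiveWords) :
    m = 1 ∨ ∃ n ∈ positiveWords, m = n * (genA * genB) ∨ m = n * (genA * genB ^ 2) := by
  induction hm using Submonoid.closure_induction_right with
  | one => exact Or.inl rfl
  | mul_right n hn x hx _ =>
    refine Or.inr ⟨n, hn, ?_⟩
    rcases hx with rfl | rfl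
    · exact Or.inl rfl
    · exact Or.inr rfl

theorem entries_toSL2Z_of_mem_positiveWords {m : PushoutI (fam2 incl24 incl26)}
    (hm : m ∈ positiveWords) :
    1 ≤ toSL2Z m 0 0 ∧ 1 ≤ toSL2Z m 1 1 ∧ 0 ≤ toSL2Z m 0 1 ∧ 0 ≤ toSL2Z m 1 0 ∧
      (m = 1 ∨ 1 ≤ toSL2Z m 0 1 + toSL2Z m 1 0) := by
  have hL : (toSL2Z (genA * genB) : Matrix (Fin 2) (Fin 2) ℤ) = !![1, 0; 1, 1] := by
    rw [map_mul, toSL2Z_genA, toSL2Z_genB]; decide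
  have hT : (toSL2Z (genA * genB ^ 2) : Matrix (Fin 2) (Fin 2) ℤ) = !![1, 1; 0, 1] := by
    rw [map_mul, map_pow, toSL2Z_genA, toSL2Z_genB]; decide
  induction hm using Submonoid.closure_induction_right with
  | one => simp
  | mul_right n hn x hx ih =>
    obtain ⟨h1, h2, h3, h4, -⟩ := ih
    rcases hx with rfl | rfl
    · rw [map_mul, Matrix.SpecialLinearGroup.coe_mul, hL]
      simp [Matrix.mul_apply, Fin.sum_univ_two]
      omega
    · rw [map_mul, Matrix.SpecialLinearGroup.coe_mul, hT]
      simp [Matrix.mul_apply, Fin.sum_univ_two]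
      omega

/-- Every element of the amalgam is `cⁱ bʲ m aᵏ` with `c = a²` central and `m` a positive word. -/
theorem exists_normal_form (x : PushoutI (fam2 incl24 incl26)) :
    ∃ m ∈ positiveWords, ∃ i < 2, ∃ j < 3, ∃ k < 2,
      x = (genA ^ 2) ^ i * genB ^ j * m * genA ^ k := by
  have hA4 := genA_pow_four
  have hAB := genA_sq_eq_genB_pow
  have hcB : Commute (genA ^ 2) genB := hAB ▸ Commute.pow_self genB 3
  have hcA : Commute (genA ^ 2) genA := Commute.pow_self genA 2
  have hc2 : (genA ^ 2) ^ 2 = 1 := by rw [← pow_mul]; exact hA4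
  have hcentral : ∀ y, Commute (genA ^ 2) y := by
    intro y
    refine pushout_induction incl24 incl26 y (fun a => ?_) (fun b => ?_) (fun _ _ => .mul_right)
    · rw [of_true_eq_genA_pow]; exact hcA.pow_right _
    · rw [of_false_eq_genB_pow]; exact hcB.pow_right _
  -- it suffices to treat an arbitrary power of the central element
  let P : PushoutI (fam2 incl24 incl26) → Prop := fun x =>
    ∃ m ∈ positiveWords, ∃ i, ∃ j < 3, ∃ k < 2, x = (genA ^ 2) ^ i * genB ^ j * m * genA ^ k
  have hPc : ∀ x, P x → P (genA ^ 2 * x) := by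
    rintro _ ⟨m, hm, i, j, hj, k, hk, rfl⟩
    exact ⟨m, hm, i + 1, j, hj, k, hk, by rw [pow_succ' _ i]; simp only [mul_assoc]⟩
  have hPA : ∀ x, P x → P (x * genA) := by
    rintro _ ⟨m, hm, i, j, hj, k, hk, rfl⟩
    interval_cases k
    · exact ⟨m, hm, i, j, hj, 1, by simp, by simp⟩
    · have : (genA ^ 2) ^ i * genB ^ j * m * genA ^ 1 * genA =
          genA ^ 2 * ((genA ^ 2) ^ i * genB ^ j * m * genA ^ 0) := by
        rw [(hcentral _).eq, pow_zero, mul_one, pow_one, mul_assoc, ← pow_two]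
      rw [this]
      exact hPc _ ⟨m, hm, i, j, hj, 0, by simp, rfl⟩
  have hPB : ∀ x, P x → P (x * genB) := by
    rintro _ ⟨m, hm, i, j, hj, k, hk, rfl⟩
    interval_cases k
    · rcases positiveWords_cases hm with rfl | ⟨n, hn, rfl | rfl⟩
      · by_cases hj2 : j + 1 < 3
        · exact ⟨1, hm, i, j + 1, hj2, 0, by simp, by simp [pow_succ, mul_assoc]⟩
        · obtain rfl : j = 2 := by omega
          refine ⟨1, hm, i + 1, 0, by simp, 0, by simp, ?_⟩
          rw [pow_succ (genA ^ 2) i, hAB]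
          simp [pow_succ, mul_assoc]
      · refine ⟨n * (genA * genB ^ 2), mul_mem hn (Submonoid.subset_closure (by simp)), i, j, hj, 0,
          by simp, ?_⟩
        simp [pow_two, mul_assoc]
      · have : (genA ^ 2) ^ i * genB ^ j * (n * (genA * genB ^ 2)) * genA ^ 0 * genB =
            genA ^ 2 * ((genA ^ 2) ^ i * genB ^ j * n * genA ^ 1) := by
          rw [(hcentral _).eq, hAB]
          simp [pow_succ, mul_assoc]
        rw [this]
        exact hPc _ ⟨n, hn, i, j, hj, 1, by simp, rfl⟩
    · refine ⟨m * (genA * genB), mul_mem hm (Submonoid.subset_closure (by simp)), i, j, hj, 0,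
          by simp, ?_⟩
      simp [mul_assoc]
  have hpow : ∀ y, (∀ x, P x → P (x * y)) → ∀ (n : ℕ) x, P x → P (x * y ^ n) := by
    intro y hy n
    induction n with
    | zero => simp
    | succ n ih => intro x hx; rw [pow_succ, ← mul_assoc]; exact hy _ (ih x hx)
  have hPmul : ∀ y x, P x → P (x * y) := by
    intro y
    refine pushout_induction incl24 incl26 (motive := fun y => ∀ x, P x → P (x * y)) y
      (fun a => ?_) (fun b => ?_) (fun u v hu hv x hx => ?_)
    · rw [of_true_eq_genA_pow]; exact hpow _ hPA _
    · rw [of_false_eq_genB_pow]; exact hpow _ hPB _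
    · rw [← mul_assoc]; exact hv _ (hu _ hx)
  obtain ⟨m, hm, i, j, hj, k, hk, hx⟩ := hPmul x 1 ⟨1, one_mem _, 0, 0, by simp, 0, by simp, by simp⟩
  refine ⟨m, hm, i % 2, Nat.mod_lt _ two_pos, j, hj, k, hk, ?_⟩
  rw [← pow_eq_pow_mod i hc2, ← hx, one_mul]

theorem toSL2Z_injective : Function.Injective toSL2Z := by
  rw [injective_iff_map_eq_one]
  intro x hx
  obtain ⟨m, hm, i, hi, j, hj, k, hk, rfl⟩ := exists_normal_form x
  obtain ⟨h1, h2, h3, h4, h5⟩ := entries_toSL2Z_of_mem_positiveWords hm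
  simp only [map_mul, map_pow, toSL2Z_genA, toSL2Z_genB] at hx
  have hM : toSL2Z m = ((S ^ 2) ^ i * sixGen ^ j)⁻¹ * (S ^ k)⁻¹ := by
    rw [eq_mul_inv_iff_mul_eq, ← mul_eq_one_iff_eq_inv', ← mul_assoc, hx]
  have hfinite : ∀ (i : Fin 2) (j : Fin 3) (k : Fin 2),
      let N := ((S ^ 2) ^ i.val * sixGen ^ j.val)⁻¹ * (S ^ k.val)⁻¹
      1 ≤ N 0 0 ∧ 1 ≤ N 1 1 ∧ 0 ≤ N 0 1 ∧ 0 ≤ N 1 0 → i.val = 0 ∧ j.val = 0 ∧ k.val = 0 := by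
    decide
  rw [hM] at h1 h2 h3 h4
  obtain ⟨rfl, rfl, rfl⟩ := hfinite ⟨i, hi⟩ ⟨j, hj⟩ ⟨k, hk⟩ ⟨h1, h2, h3, h4⟩
  have hM1 : toSL2Z m = 1 := by simpa using hM
  rcases h5 with rfl | h5
  · simp
  · simp [hM1] at h5

theorem nonempty_mulEquiv_SL2Z :
    Nonempty (PushoutI (fam2 incl24 incl26) ≃* Matrix.SpecialLinearGroup (Fin 2) ℤ) :=
  ⟨MulEquiv.ofBijective toSL2Z ⟨toSL2Z_injective, toSL2Z_surjective⟩⟩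

end modular

theorem natCard_range_of_injective {K L : Type*} [Group K] [Group L] {f : K →* L}
    (hf : Function.Injective f) : Nat.card f.range = Nat.card K :=
  (Nat.card_congr (MonoidHom.ofInjective hf).toEquiv).symm

theorem eventually_inf_eq_bot {G : Type*} [Group G] {H : ℕ → Subgroup G} (hH : Antitone H)
    (hbot : (⨅ i, H i) = ⊥) (A : Subgroup G) [Finite A] : ∀ᶠ i in atTop, H i ⊓ A = ⊥ := by
  have h : ∀ a : A, ∀ᶠ i in atTop, (a : G) ∈ H i → a = 1 := by
    intro a
    by_cases ha : a = 1
    · exact Eventually.of_forall fun _ _ => ha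
    · have : (a : G) ∉ ⨅ i, H i := by
        rw [hbot, Subgroup.mem_bot]
        exact fun h => ha (Subtype.ext h)
      rw [Subgroup.mem_iInf, not_forall] at this
      obtain ⟨i, hi⟩ := this
      filter_upwards [eventually_ge_atTop i] with j hj hmem
      exact absurd (hH hj hmem) hi
  filter_upwards [eventually_all.2 h] with i hi
  rw [eq_bot_iff]
  rintro a ⟨haH, haA⟩
  exact congrArg Subtype.val (hi ⟨a, haA⟩ haH)

/-- The amalgam `ℤ/4 *_{ℤ/2} ℤ/6` is isomorphic to `SL(2, ℤ)`, and its rank gradient with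
respect to any descending chain of finite-index normal subgroups with trivial
intersection equals `1/12`. -/
theorem rank_gradient_SL2Z :
    Nonempty (Monoid.PushoutI (fam2 incl24 incl26) ≃*
        Matrix.SpecialLinearGroup (Fin 2) ℤ) ∧
    ∀ H : ℕ → Subgroup (Monoid.PushoutI (fam2 incl24 incl26)),
      (∀ i, H (i + 1) ≤ H i) → (∀ i, (H i).Normal) → (∀ i, (H i).index ≠ 0) →
      (⨅ i, H i) = ⊥ →
      Tendsto (fun i => ((ngen ↥(H i) : ℝ) - 1) / ((H i).index : ℝ)) atTop
        (nhds (1 / 12)) := by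
  refine ⟨nonempty_mulEquiv_SL2Z, fun H hanti hnormal hindex hbot => ?_⟩
  have hof := Monoid.PushoutI.of_injective fam2_injective
  have cardA : Nat.card (Monoid.PushoutI.of (φ := fam2 incl24 incl26) true).range = 4 :=
    (natCard_range_of_injective (hof true)).trans (Nat.card_zmod 4)
  have cardB : Nat.card (Monoid.PushoutI.of (φ := fam2 incl24 incl26) false).range = 6 :=
    (natCard_range_of_injective (hof false)).trans (Nat.card_zmod 6)
  have cardC : Nat.card (Monoid.PushoutI.base (fam2 incl24 incl26)).range = 2 :=
    (natCard_range_of_injective (Monoid.PushoutI.base_injective fam2_injective)).trans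
      (Nat.card_zmod 2)
  have : Finite (Monoid.PushoutI.of (φ := fam2 incl24 incl26) true).range :=
    Nat.finite_of_card_ne_zero (by rw [cardA]; simp)
  have : Finite (Monoid.PushoutI.of (φ := fam2 incl24 incl26) false).range :=
    Nat.finite_of_card_ne_zero (by rw [cardB]; simp)
  refine tendsto_const_nhds.congr' ?_
  filter_upwards [
    eventually_inf_eq_bot (antitone_nat_of_succ_le hanti) hbot
      (Monoid.PushoutI.of (φ := fam2 incl24 incl26) true).range,
    eventually_inf_eq_bot (antitone_nat_of_succ_le hanti) hbot
      (Monoid.PushoutI.of (φ := fam2 incl24 incl26) false).range] with i hA hB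
  have := hnormal i
  rw [ngen_of_amalgam (range_base_le incl24 incl26 true) (range_base_le incl24 incl26 false)
    (range_of_sup_range_of incl24 incl26) (exists_potential incl24 incl26) (H i) (hindex i) hA hB,
    cardA, cardB, cardC, mul_div_cancel_left₀ _ (Nat.cast_ne_zero.2 (hindex i))]
  norm_num
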